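/- arXiv:2510.05280 — 4 statements merged into one kernel-verified Lean document; each statement's English description precedes it below -/
import Mathlib

section
/- Let A, B, A', B' be four points in Euclidean 3-space such that dist A B = dist A' B' and dist A B' = dist A' B. Then there exists a line l (a nonempty affine subspace of ℝ³ whose direction has finrank 1) such that the reflection across l maps A to A' and maps B to B' (since this reflection is involutive and is the half-rotation about l, it swaps A with A' and B with B'). -/
open scoped RealInnerProductSpace in
/-- In a space of dimension greater than two, some nonzero vector is orthogonal to two given ones. -/
theorem exists_ne_zero_inner_eq_zero_pair {V : Type*} [NormedAddCommGroup V]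
    [InnerProductSpace ℝ V] [FiniteDimensional ℝ V] (hV : 2 < Module.finrank ℝ V) (a b : V) :
    ∃ u : V, u ≠ 0 ∧ ⟪u, a⟫ = 0 ∧ ⟪u, b⟫ = 0 := by
  classical
  have hle : Module.finrank ℝ (Submodule.span ℝ (({a, b} : Finset V) : Set V)) ≤ 2 :=
    (finrank_span_finset_le_card _).trans Finset.card_le_two
  have hadd := (Submodule.span ℝ (({a, b} : Finset V) : Set V)).finrank_add_finrank_orthogonal
  have hne : (Submodule.span ℝ (({a, b} : Finset V) : Set V))ᗮ ≠ ⊥ := by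
    intro h
    rw [h, finrank_bot] at hadd
    omega
  obtain ⟨u, hu, hu0⟩ := Submodule.exists_mem_ne_zero_of_ne_bot hne
  rw [Submodule.mem_orthogonal'] at hu
  exact ⟨u, hu0, hu a (Submodule.subset_span (by simp)), hu b (Submodule.subset_span (by simp))⟩

/-- Reflection in `s` swaps two points whose midpoint lies on `s` and whose difference is
orthogonal to `s`. -/
theorem reflection_eq_of_midpoint_mem {V : Type*} [NormedAddCommGroup V] [InnerProductSpace ℝ V]
    {s : AffineSubspace ℝ V} [Nonempty s] [s.direction.HasOrthogonalProjection] {p q : V}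
    (hm : midpoint ℝ p q ∈ s) (ho : p - q ∈ s.directionᗮ) :
    EuclideanGeometry.reflection s p = q := by
  have h := EuclideanGeometry.reflection_orthogonal_vadd hm
    (s.directionᗮ.smul_mem (1 / 2 : ℝ) ho)
  have hp : (1 / 2 : ℝ) • (p - q) +ᵥ midpoint ℝ p q = p := by
    rw [midpoint_eq_smul_add, vadd_eq_add, invOf_eq_inv]
    module
  have hq : -((1 / 2 : ℝ) • (p - q)) +ᵥ midpoint ℝ p q = q := by
    rw [midpoint_eq_smul_add, vadd_eq_add, invOf_eq_inv]
    module
  rwa [hp, hq] at h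

open scoped RealInnerProductSpace in
/-- If opposite sides of the skew quadrilateral `A B A' B'` have equal lengths, the segment joining
the midpoints of its diagonals is orthogonal to both diagonals. -/
theorem inner_midpoint_sub_midpoint_eq_zero {V : Type*} [NormedAddCommGroup V]
    [InnerProductSpace ℝ V] {A B A' B' : V} (h1 : dist A B = dist A' B')
    (h2 : dist A B' = dist A' B) :
    ⟪midpoint ℝ B B' - midpoint ℝ A A', A - A'⟫ = 0 ∧
      ⟪midpoint ℝ B B' - midpoint ℝ A A', B - B'⟫ = 0 := by
  rw [dist_eq_norm, dist_eq_norm, ← sq_eq_sq₀ (norm_nonneg _) (norm_nonneg _),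
    ← real_inner_self_eq_norm_sq, ← real_inner_self_eq_norm_sq] at h1 h2
  simp only [midpoint_eq_smul_add, invOf_eq_inv, inner_sub_left, inner_sub_right, inner_add_left,
    real_inner_smul_left] at h1 h2 ⊢
  have := real_inner_comm A B
  have := real_inner_comm A B'
  have := real_inner_comm A' B
  have := real_inner_comm A' B'
  have := real_inner_comm A A'
  have := real_inner_comm B B'
  constructor <;> linarith

theorem exists_line_reflection_swapping
    (A B A' B' : EuclideanSpace ℝ (Fin 3))
    (h1 : dist A B = dist A' B') (h2 : dist A B' = dist A' B) :
    ∃ (l : AffineSubspace ℝ (EuclideanSpace ℝ (Fin 3))) (hne : Nonempty l),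
      Module.finrank ℝ l.direction = 1 ∧
      (letI := hne
       EuclideanGeometry.reflection l A = A' ∧ EuclideanGeometry.reflection l B = B') := by
  obtain ⟨u, hu0, huA, huB, hu⟩ : ∃ u : EuclideanSpace ℝ (Fin 3), u ≠ 0 ∧
      inner ℝ u (A - A') = 0 ∧ inner ℝ u (B - B') = 0 ∧
      midpoint ℝ B B' - midpoint ℝ A A' ∈ Submodule.span ℝ {u} := by
    obtain ⟨hA, hB⟩ := inner_midpoint_sub_midpoint_eq_zero h1 h2
    by_cases hd : midpoint ℝ B B' - midpoint ℝ A A' = 0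
    · obtain ⟨u, hu0, huA, huB⟩ :=
        exists_ne_zero_inner_eq_zero_pair (by simp) (A - A') (B - B')
      exact ⟨u, hu0, huA, huB, hd ▸ Submodule.zero_mem _⟩
    · exact ⟨_, hd, hA, hB, Submodule.mem_span_singleton_self _⟩
  refine ⟨AffineSubspace.mk' (midpoint ℝ A A') (Submodule.span ℝ {u}),
    ⟨⟨_, AffineSubspace.self_mem_mk' _ _⟩⟩, ?_, ?_, ?_⟩
  · rw [AffineSubspace.direction_mk', finrank_span_singleton hu0]
  · refine reflection_eq_of_midpoint_mem (AffineSubspace.self_mem_mk' _ _) ?_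
    rwa [AffineSubspace.direction_mk', Submodule.mem_orthogonal_singleton_iff_inner_right]
  · refine reflection_eq_of_midpoint_mem (AffineSubspace.mem_mk'.2 hu) ?_
    rwa [AffineSubspace.direction_mk', Submodule.mem_orthogonal_singleton_iff_inner_right]
end

section
/- Let A, B, A', B' be four points in Euclidean 3-space such that dist A B = dist A' B' and dist A B' = dist A' B. Let X be the midpoint of A and A', and Y the midpoint of B and B', and assume X ≠ Y. Let l be the affine span of {X, Y} (a line). Then the reflection across l maps A to A' and maps B to B'. -/
/-- Reflection across a line through the midpoint of `a` and `a'`, perpendicular to the segment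
joining them, maps `a` to `a'`. -/
theorem reflection_affineSpan_pair_eq_of_inner_eq_zero {V : Type*} [NormedAddCommGroup V]
    [InnerProductSpace ℝ V] [FiniteDimensional ℝ V] {a a' x y : V}
    (hx : x = midpoint ℝ a a') (h : inner ℝ (y - x) (a - x) = 0) :
    EuclideanGeometry.reflection (affineSpan ℝ {x, y}) a = a' := by
  have hv : a - x ∈ (affineSpan ℝ {x, y}).directionᗮ := by
    rw [direction_affineSpan, vectorSpan_pair_rev, Submodule.mem_orthogonal_singleton_iff_inner_right]
    simpa using h
  have key := EuclideanGeometry.reflection_orthogonal_vadd (left_mem_affineSpan_pair ℝ x y) hv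
  have ha : (a - x) +ᵥ x = a := by simp
  have ha' : -(a - x) +ᵥ x = a' := by
    rw [vadd_eq_add, hx, midpoint_eq_smul_add, invOf_eq_inv]
    module
  rwa [ha, ha'] at key

/-- If `‖d + u - v‖ = ‖d - u + v‖` and `‖d + u + v‖ = ‖d - u - v‖`, then `d` is orthogonal to
both `u` and `v`. -/
theorem inner_eq_zero_of_norm_eq {V : Type*} [NormedAddCommGroup V] [InnerProductSpace ℝ V]
    {d u v : V} (h₁ : ‖d + (u - v)‖ = ‖d - (u - v)‖) (h₂ : ‖d + (u + v)‖ = ‖d - (u + v)‖) :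
    inner ℝ d u = 0 ∧ inner ℝ d v = 0 := by
  have e₁ := congrArg (· ^ 2) h₁
  have e₂ := congrArg (· ^ 2) h₂
  simp only [norm_add_sq_real d, norm_sub_sq_real d, inner_add_right, inner_sub_right] at e₁ e₂
  constructor <;> linarith

theorem reflection_affineSpan_midpoints_swaps
    (A B A' B' : EuclideanSpace ℝ (Fin 3))
    (h1 : dist A B = dist A' B') (h2 : dist A B' = dist A' B)
    (X Y : EuclideanSpace ℝ (Fin 3))
    (hX : X = midpoint ℝ A A') (hY : Y = midpoint ℝ B B') (hXY : X ≠ Y) :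
    EuclideanGeometry.reflection (affineSpan ℝ {X, Y}) A = A' ∧
      EuclideanGeometry.reflection (affineSpan ℝ {X, Y}) B = B' := by
  have hA : A' = X + X - A := by rw [hX, midpoint_add_self]; abel
  have hB : B' = Y + Y - B := by rw [hY, midpoint_add_self]; abel
  rw [dist_eq_norm, dist_eq_norm, hA, hB] at h1 h2
  obtain ⟨hu, hv⟩ := inner_eq_zero_of_norm_eq (d := X - Y) (u := A - X) (v := B - Y)
    (by rwa [show X - Y + (A - X - (B - Y)) = A - B by abel,
      show X - Y - (A - X - (B - Y)) = X + X - A - (Y + Y - B) by abel])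
    (by rwa [show X - Y + (A - X + (B - Y)) = A - (Y + Y - B) by abel,
      show X - Y - (A - X + (B - Y)) = X + X - A - B by abel])
  constructor
  · refine reflection_affineSpan_pair_eq_of_inner_eq_zero hX ?_
    rw [← neg_sub, inner_neg_left, hu, neg_zero]
  · rw [EuclideanGeometry.eq_reflection_of_eq_subspace
      (congrArg (affineSpan ℝ) (Set.pair_comm X Y)) B]
    exact reflection_affineSpan_pair_eq_of_inner_eq_zero hY hv
end

section
/- Let A, B, A', B' be four points in Euclidean 3-space such that dist A B = dist A' B' and dist A B' = dist A' B. If the open segments joining A to A' and joining B to B' have a common point (the diagonals AA' and BB' intersect), then the midpoint of A and A' equals the midpoint of B and B' (the quadrilateral ABA'B' is a parallelogram). -/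
theorem intersecting_diagonals_parallelogram
    (A B A' B' : EuclideanSpace ℝ (Fin 3))
    (h1 : dist A B = dist A' B') (h2 : dist A B' = dist A' B)
    (hmeet : ∃ P : EuclideanSpace ℝ (Fin 3),
      P ∈ openSegment ℝ A A' ∧ P ∈ openSegment ℝ B B') :
    midpoint ℝ A A' = midpoint ℝ B B' := by
  obtain ⟨P, ⟨a, b, -, -, hab, hA⟩, ⟨c, e, -, -, hce, hB⟩⟩ := hmeet
  rw [dist_eq_norm, dist_eq_norm, ← real_inner_add_sub_eq_zero_iff] at h1 h2
  set d := A + A' - B - B' with hd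
  rw [show A - B - (A' - B') = (A - A') - (B - B') by abel,
    show A - B + (A' - B') = d by rw [hd]; abel, inner_sub_right] at h1
  rw [show A - B' - (A' - B) = (A - A') + (B - B') by abel,
    show A - B' + (A' - B) = d by rw [hd]; abel, inner_add_right] at h2
  have hdiag : d = (b - a) • (A - A') + (c - e) • (B - B') := by
    obtain rfl : b = 1 - a := by linarith
    obtain rfl : e = 1 - c := by linarith
    rw [hd]
    linear_combination (norm := module) (2 : ℝ) • hA.trans hB.symm
  have hd0 : d = 0 := by
    rw [← inner_self_eq_zero (𝕜 := ℝ)]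
    nth_rw 2 [hdiag]
    rw [inner_add_right, real_inner_smul_right, real_inner_smul_right]
    linear_combination (b - a) * (h1 + h2) / 2 + (c - e) * (h2 - h1) / 2
  rw [midpoint_eq_smul_add, midpoint_eq_smul_add]
  congr 1
  rw [← sub_eq_zero, ← hd0, hd]
  abel
end

section
/- Let A, B, A', B' be four points in Euclidean 3-space and suppose midpoint A A' = midpoint B B' = O (the quadrilateral ABA'B' is a parallelogram with center O). Then there exists a line l (a nonempty affine subspace whose direction has finrank 1) containing O such that the reflection across l maps A to A' and maps B to B' (a half-rotation about a line through O perpendicular to the plane of the four points swaps A with A' and B with B'). -/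
open Module in
theorem exists_ne_zero_inner_eq_zero_pair_s5 {E : Type*} [NormedAddCommGroup E]
    [InnerProductSpace ℝ E] [FiniteDimensional ℝ E] (hE : 2 < finrank ℝ E) (u v : E) :
    ∃ n : E, n ≠ 0 ∧ inner ℝ n u = 0 ∧ inner ℝ n v = 0 := by
  classical
  set K : Submodule ℝ E := Submodule.span ℝ {u, v}
  have hK : finrank ℝ K ≤ 2 := by
    have h := finrank_span_finset_le_card (R := ℝ) ({u, v} : Finset E)
    rw [Finset.coe_pair] at h
    exact h.trans Finset.card_le_two
  have hadd := K.finrank_add_finrank_orthogonal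
  have hpos : Kᗮ ≠ ⊥ := by
    intro h
    rw [h, finrank_bot] at hadd
    omega
  obtain ⟨n, hn, hn0⟩ := Submodule.exists_mem_ne_zero_of_ne_bot hpos
  rw [Submodule.mem_orthogonal'] at hn
  exact ⟨n, hn0, hn u (Submodule.subset_span (by simp)), hn v (Submodule.subset_span (by simp))⟩

theorem reflection_eq_of_midpoint_eq {V P : Type*} [NormedAddCommGroup V]
    [InnerProductSpace ℝ V] [MetricSpace P] [NormedAddTorsor V P] (s : AffineSubspace ℝ P)
    [Nonempty s] [s.direction.HasOrthogonalProjection] {p q c : P} (hc : c ∈ s)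
    (hmid : midpoint ℝ p q = c) (hp : p -ᵥ c ∈ s.directionᗮ) :
    EuclideanGeometry.reflection s p = q := by
  have h := EuclideanGeometry.reflection_orthogonal_vadd hc hp
  rw [vsub_vadd, neg_vsub_eq_vsub_rev] at h
  rw [h, ← hmid, midpoint_vsub_left, ← right_vsub_midpoint, vsub_vadd]

theorem parallelogram_exists_line_reflection
    (A B A' B' O : EuclideanSpace ℝ (Fin 3))
    (hA : midpoint ℝ A A' = O) (hB : midpoint ℝ B B' = O) :
    ∃ (l : AffineSubspace ℝ (EuclideanSpace ℝ (Fin 3))) (hne : Nonempty l),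
      Module.finrank ℝ l.direction = 1 ∧ O ∈ l ∧
      (letI := hne
       EuclideanGeometry.reflection l A = A' ∧ EuclideanGeometry.reflection l B = B') := by
  obtain ⟨n, hn, hnA, hnB⟩ :=
    exists_ne_zero_inner_eq_zero_pair_s5 (by simp) (A -ᵥ O) (B -ᵥ O)
  have hO : O ∈ AffineSubspace.mk' O (ℝ ∙ n) := AffineSubspace.self_mem_mk' _ _
  refine ⟨AffineSubspace.mk' O (ℝ ∙ n), ⟨⟨O, hO⟩⟩, ?_, hO, ?_, ?_⟩
  · rw [AffineSubspace.direction_mk', finrank_span_singleton hn]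
  · refine @reflection_eq_of_midpoint_eq _ _ _ _ _ _ _ ⟨⟨O, hO⟩⟩ _ _ _ _ hO hA ?_
    rwa [AffineSubspace.direction_mk', Submodule.mem_orthogonal_singleton_iff_inner_right]
  · refine @reflection_eq_of_midpoint_eq _ _ _ _ _ _ _ ⟨⟨O, hO⟩⟩ _ _ _ _ hO hB ?_
    rwa [AffineSubspace.direction_mk', Submodule.mem_orthogonal_singleton_iff_inner_right]
end
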